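/- Let K ⊆ ℝⁿ be a compact set with nonempty interior satisfying Assumption 1, equipped with the Lebesgue measure (weight w ≡ 1). Let β ≥ 1 be an integer, let f ∈ C^β(ℝⁿ, ℝ), and let a be a global minimizer of f on K such that all partial derivatives D^α f(a) vanish for every multi-index α with 1 ≤ |α| ≤ β − 1. Then there exists a constant c > 0 (depending only on K, f and β) such that for every integer r ≥ 2 one has E^{(r)}_K(f) ≤ c · (log r)^β / r^β. -/

import Mathlib

open MeasureTheory

noncomputable section

/-- A polynomial is a sum of squares. -/
def IsSOS {n : ℕ} (q : MvPolynomial (Fin n) ℝ) : Prop :=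
  ∃ (m : ℕ) (p : Fin m → MvPolynomial (Fin n) ℝ), q = ∑ i, p i ^ 2

/-- The Lasserre measure-based upper bound `f^{(r)}_{K,w}`: the infimum of
`∫_K f q w dx` over sum-of-squares polynomials `q` of degree at most `2r`
with `∫_K q w dx = 1`. -/
noncomputable def lasserre {n : ℕ} (r : ℕ) (K : Set (EuclideanSpace ℝ (Fin n)))
    (w f : EuclideanSpace ℝ (Fin n) → ℝ) : ℝ :=
  sInf { v : ℝ | ∃ q : MvPolynomial (Fin n) ℝ, IsSOS q ∧ q.totalDegree ≤ 2 * r ∧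
    (∫ x in K, MvPolynomial.eval (fun i => x i) q * w x) = 1 ∧
    v = ∫ x in K, f x * MvPolynomial.eval (fun i => x i) q * w x }

/-- The error `E^{(r)}_{K,w}(f) = f^{(r)}_{K,w} - min_{x ∈ K} f(x)`. -/
noncomputable def lasserreError {n : ℕ} (r : ℕ) (K : Set (EuclideanSpace ℝ (Fin n)))
    (w f : EuclideanSpace ℝ (Fin n) → ℝ) : ℝ :=
  lasserre r K w f - sInf (f '' K)

/-- Assumption 1: there exist `ε_K, η_K > 0` such that
`vol(B_δ(x) ∩ K) ≥ η_K · δⁿ · vol(B₁(0))` for all `x ∈ K` and `0 < δ ≤ ε_K`. -/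
def Assumption1 {n : ℕ} (K : Set (EuclideanSpace ℝ (Fin n))) : Prop :=
  ∃ εK ηK : ℝ, 0 < εK ∧ 0 < ηK ∧ ∀ x ∈ K, ∀ δ : ℝ, 0 < δ → δ ≤ εK →
    ENNReal.ofReal (ηK * δ ^ n) *
        volume (Metric.closedBall (0 : EuclideanSpace ℝ (Fin n)) 1) ≤
      volume (Metric.closedBall x δ ∩ K)

open Polynomial.Chebyshev in
/-- The Chebyshev polynomial `T m` is at least `cosh (m θ)` on `[cosh θ, ∞)`. -/
theorem cosh_mul_le_eval_T (m : ℕ) {θ x : ℝ} (hθ : 0 ≤ θ) (hx : Real.cosh θ ≤ x) :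
    Real.cosh (m * θ) ≤ (T ℝ m).eval x := by
  have h1 : 1 ≤ x := (Real.one_le_cosh θ).trans hx
  have h0 : 0 ≤ Real.arcosh x := Real.arcosh_nonneg h1
  rw [← Real.cosh_arcosh h1, T_real_cosh]
  have h : θ ≤ Real.arcosh x := by
    rw [← Real.cosh_arcosh h1, Real.cosh_le_cosh, abs_of_nonneg hθ, abs_of_nonneg h0] at hx
    exact hx
  rw [Real.cosh_le_cosh, abs_of_nonneg (by positivity), abs_of_nonneg (by positivity)]
  push_cast
  gcongr

theorem cosh_le_one_add_sq {θ : ℝ} (hθ : |θ| ≤ 1) : Real.cosh θ ≤ 1 + θ ^ 2 := by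
  have hsq : θ ^ 2 ≤ 1 := (sq_le_one_iff_abs_le_one θ).2 hθ
  have h := Real.abs_exp_sub_one_le (x := θ ^ 2 / 2)
    (by rw [abs_of_nonneg (by positivity)]; linarith)
  rw [abs_of_nonneg (by positivity : 0 ≤ θ ^ 2 / 2)] at h
  linarith [Real.cosh_le_exp_half_sq θ, le_abs_self (Real.exp (θ ^ 2 / 2) - 1)]

theorem totalDegree_aeval_le {σ R : Type*} [CommSemiring R] (u : MvPolynomial σ R)
    (p : Polynomial R) :
    (Polynomial.aeval u p).totalDegree ≤ p.natDegree * u.totalDegree := by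
  rw [Polynomial.aeval_eq_sum_range]
  refine MvPolynomial.totalDegree_finsetSum_le fun i hi => ?_
  refine (MvPolynomial.totalDegree_smul_le _ _).trans ((MvPolynomial.totalDegree_pow _ _).trans ?_)
  exact Nat.mul_le_mul_right _ (Nat.lt_succ_iff.1 (Finset.mem_range.1 hi))

/-- The quadratic polynomial `1 + (δ² - ‖x - a‖²) / D²`. -/
def radialQuadratic {n : ℕ} (a : EuclideanSpace ℝ (Fin n)) (δ D : ℝ) : MvPolynomial (Fin n) ℝ :=
  MvPolynomial.C (1 + δ ^ 2 / D ^ 2) -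
    MvPolynomial.C (1 / D ^ 2) * ∑ i, (MvPolynomial.X i - MvPolynomial.C (a i)) ^ 2

theorem eval_radialQuadratic {n : ℕ} (a x : EuclideanSpace ℝ (Fin n)) (δ D : ℝ) :
    MvPolynomial.eval (fun i => x i) (radialQuadratic a δ D) =
      1 + (δ ^ 2 - ‖x - a‖ ^ 2) / D ^ 2 := by
  simp only [radialQuadratic, map_sub, map_mul, map_sum, map_pow, MvPolynomial.eval_C,
    MvPolynomial.eval_X, EuclideanSpace.norm_sq_eq, PiLp.sub_apply, Real.norm_eq_abs, sq_abs]
  ring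

theorem totalDegree_radialQuadratic_le {n : ℕ} (a : EuclideanSpace ℝ (Fin n)) (δ D : ℝ) :
    (radialQuadratic a δ D).totalDegree ≤ 2 := by
  refine (MvPolynomial.totalDegree_sub _ _).trans (max_le ((MvPolynomial.totalDegree_C _).trans_le zero_le_two) ?_)
  refine (MvPolynomial.totalDegree_mul _ _).trans ?_
  rw [MvPolynomial.totalDegree_C, zero_add]
  refine MvPolynomial.totalDegree_finsetSum_le fun i _ => ?_
  refine (MvPolynomial.totalDegree_pow _ _).trans ?_
  have := (MvPolynomial.totalDegree_sub_C_le (MvPolynomial.X i) (a i)).trans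
    (MvPolynomial.totalDegree_X (R := ℝ) i).le
  omega

/-- The Chebyshev polynomial `T m` composed with `radialQuadratic a δ D`: bounded by one on the
annulus `δ ≤ ‖x - a‖ ≤ D` and large near `a`. -/
def chebyshevNeedle {n : ℕ} (m : ℕ) (a : EuclideanSpace ℝ (Fin n)) (δ D : ℝ) :
    MvPolynomial (Fin n) ℝ :=
  Polynomial.aeval (radialQuadratic a δ D) (Polynomial.Chebyshev.T ℝ m)

theorem totalDegree_chebyshevNeedle_le {n : ℕ} (m : ℕ) (a : EuclideanSpace ℝ (Fin n)) (δ D : ℝ) :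
    (chebyshevNeedle m a δ D).totalDegree ≤ m * 2 := by
  refine (totalDegree_aeval_le _ _).trans ?_
  rw [Polynomial.Chebyshev.natDegree_T, Int.natAbs_natCast]
  exact Nat.mul_le_mul_left _ (totalDegree_radialQuadratic_le a δ D)

theorem eval_chebyshevNeedle {n : ℕ} (m : ℕ) (a x : EuclideanSpace ℝ (Fin n)) (δ D : ℝ) :
    MvPolynomial.eval (fun i => x i) (chebyshevNeedle m a δ D) =
      (Polynomial.Chebyshev.T ℝ m).eval (1 + (δ ^ 2 - ‖x - a‖ ^ 2) / D ^ 2) := by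
  rw [← eval_radialQuadratic, chebyshevNeedle, Polynomial.aeval_def, Polynomial.hom_eval₂,
    Polynomial.eval]
  congr 1
  ext
  simp

theorem eval_chebyshevNeedle_sq_le_one {n : ℕ} (m : ℕ) {a x : EuclideanSpace ℝ (Fin n)}
    {δ D : ℝ} (hδ : 0 < δ) (hD : 0 < D) (hx : δ ≤ ‖x - a‖) (hxD : ‖x - a‖ ≤ D) :
    MvPolynomial.eval (fun i => x i) (chebyshevNeedle m a δ D) ^ 2 ≤ 1 := by
  rw [eval_chebyshevNeedle, sq_le_one_iff_abs_le_one]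
  apply Polynomial.Chebyshev.abs_eval_T_real_le_one
  have h1 : (δ ^ 2 - ‖x - a‖ ^ 2) / D ^ 2 ≤ 0 :=
    div_nonpos_of_nonpos_of_nonneg (by nlinarith) (by positivity)
  have h2 : -1 ≤ (δ ^ 2 - ‖x - a‖ ^ 2) / D ^ 2 := by
    rw [le_div_iff₀ (by positivity)]
    nlinarith [norm_nonneg (x - a)]
  rw [abs_le]
  constructor <;> linarith

theorem exp_div_four_le_eval_chebyshevNeedle_sq {n : ℕ} (m : ℕ) {a x : EuclideanSpace ℝ (Fin n)}
    {δ D : ℝ} (hδ : 0 < δ) (hδD : δ ≤ D) (hx : ‖x - a‖ ≤ δ / 2) :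
    Real.exp (m * δ / D) / 4 ≤
      MvPolynomial.eval (fun i => x i) (chebyshevNeedle m a δ D) ^ 2 := by
  have hD : 0 < D := hδ.trans_le hδD
  have hθ : 0 ≤ δ / (2 * D) := by positivity
  have hθ1 : |δ / (2 * D)| ≤ 1 := by
    rw [abs_of_nonneg hθ, div_le_one (by positivity)]
    linarith
  have hcosh : Real.cosh (δ / (2 * D)) ≤ 1 + (δ ^ 2 - ‖x - a‖ ^ 2) / D ^ 2 := by
    refine (cosh_le_one_add_sq hθ1).trans ?_
    have h : (δ / (2 * D)) ^ 2 = (δ ^ 2 / 4) / D ^ 2 := by field_simp; ring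
    rw [h]
    gcongr
    nlinarith [norm_nonneg (x - a)]
  have h := cosh_mul_le_eval_T m hθ hcosh
  have hexp : Real.exp (m * (δ / (2 * D))) / 2 ≤ Real.cosh (m * (δ / (2 * D))) := by
    rw [Real.cosh_eq]
    linarith [Real.exp_pos (-(m * (δ / (2 * D))))]
  rw [eval_chebyshevNeedle]
  calc Real.exp (m * δ / D) / 4 = (Real.exp (m * (δ / (2 * D))) / 2) ^ 2 := by
        rw [div_pow, ← Real.exp_nat_mul]
        norm_num
        field_simp
    _ ≤ _ := pow_le_pow_left₀ (by positivity) (hexp.trans h) 2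

theorem continuous_eval_mvPolynomial {n : ℕ} (p : MvPolynomial (Fin n) ℝ) :
    Continuous fun x : EuclideanSpace ℝ (Fin n) => MvPolynomial.eval (fun i => x i) p :=
  (MvPolynomial.continuous_eval p).comp (by fun_prop)

theorem IsSOS.eval_nonneg {n : ℕ} {q : MvPolynomial (Fin n) ℝ} (hq : IsSOS q) (x : Fin n → ℝ) :
    0 ≤ MvPolynomial.eval x q := by
  obtain ⟨m, p, rfl⟩ := hq
  simp only [map_sum, map_pow]
  positivity

/-- Any squared polynomial density bounds the Lasserre error. -/
theorem lasserreError_le_of_sq {n r : ℕ} {K : Set (EuclideanSpace ℝ (Fin n))} (hK : IsCompact K)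
    {f : EuclideanSpace ℝ (Fin n) → ℝ} (hf : Continuous f) {a : EuclideanSpace ℝ (Fin n)}
    (ha : a ∈ K) (hmin : ∀ x ∈ K, f a ≤ f x) {p : MvPolynomial (Fin n) ℝ}
    (hp : p.totalDegree ≤ r) {B : ℝ}
    (hI : 0 < ∫ x in K, MvPolynomial.eval (fun i => x i) p ^ 2)
    (hB : ∫ x in K, (f x - f a) * MvPolynomial.eval (fun i => x i) p ^ 2 ≤
      B * ∫ x in K, MvPolynomial.eval (fun i => x i) p ^ 2) :
    lasserreError r K (fun _ => 1) f ≤ B := by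
  set I := ∫ x in K, MvPolynomial.eval (fun i => x i) p ^ 2 with hIdef
  have hint {g : EuclideanSpace ℝ (Fin n) → ℝ} (hg : Continuous g) : IntegrableOn g K :=
    hg.continuousOn.integrableOn_compact hK
  have hinf : sInf (f '' K) = f a :=
    IsLeast.csInf_eq ⟨⟨a, ha, rfl⟩, by rintro _ ⟨x, hx, rfl⟩; exact hmin x hx⟩
  have hc : Real.sqrt I⁻¹ ^ 2 = I⁻¹ := Real.sq_sqrt (by positivity)
  have hp2 : Continuous fun x : EuclideanSpace ℝ (Fin n) =>
      MvPolynomial.eval (fun i => x i) p ^ 2 := (continuous_eval_mvPolynomial p).pow 2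
  have hmem : (∫ x in K, f x * MvPolynomial.eval (fun i => x i) p ^ 2) * I⁻¹ ∈
      { v : ℝ | ∃ q : MvPolynomial (Fin n) ℝ, IsSOS q ∧ q.totalDegree ≤ 2 * r ∧
        (∫ x in K, MvPolynomial.eval (fun i => x i) q * 1) = 1 ∧
        v = ∫ x in K, f x * MvPolynomial.eval (fun i => x i) q * 1 } := by
    refine ⟨(MvPolynomial.C (Real.sqrt I⁻¹) * p) ^ 2, ⟨1, fun _ => _, by simp; rfl⟩, ?_, ?_, ?_⟩
    · refine (MvPolynomial.totalDegree_pow _ _).trans (Nat.mul_le_mul_left _ ?_)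
      exact (MvPolynomial.totalDegree_mul _ _).trans (by simpa using hp)
    · simp only [map_pow, map_mul, MvPolynomial.eval_C, mul_one, mul_pow, hc]
      rw [integral_const_mul, ← hIdef, inv_mul_cancel₀ hI.ne']
    · simp only [map_pow, map_mul, MvPolynomial.eval_C, mul_one, mul_pow, hc]
      rw [← integral_mul_const]
      congr 1
      ext x
      ring
  have hbdd : BddBelow { v : ℝ | ∃ q : MvPolynomial (Fin n) ℝ, IsSOS q ∧ q.totalDegree ≤ 2 * r ∧
        (∫ x in K, MvPolynomial.eval (fun i => x i) q * 1) = 1 ∧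
        v = ∫ x in K, f x * MvPolynomial.eval (fun i => x i) q * 1 } := by
    refine ⟨f a, ?_⟩
    rintro v ⟨q, hq, -, h1, rfl⟩
    have hqc := continuous_eval_mvPolynomial q
    calc f a = ∫ x in K, f a * (MvPolynomial.eval (fun i => x i) q * 1) := by
          rw [integral_const_mul, h1, mul_one]
      _ ≤ _ := by
          refine setIntegral_mono_on (hint (by fun_prop)) (hint (by fun_prop)) hK.measurableSet
            fun x hx => ?_
          rw [mul_assoc]
          exact mul_le_mul_of_nonneg_right (hmin x hx) (by simpa using hq.eval_nonneg _)
  have hsub : ∫ x in K, (f x - f a) * MvPolynomial.eval (fun i => x i) p ^ 2 =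
      (∫ x in K, f x * MvPolynomial.eval (fun i => x i) p ^ 2) - f a * I := by
    simp only [sub_mul]
    rw [integral_sub (hint (by fun_prop)) (hint (by fun_prop)), integral_const_mul]
  rw [hsub] at hB
  rw [lasserreError, hinf, lasserre]
  refine (sub_le_sub_right (csInf_le hbdd hmem) _).trans ?_
  rw [sub_le_iff_le_add, ← div_eq_mul_inv, div_le_iff₀ hI]
  linarith

/-- A `C^k` map whose derivatives of order less than `k` vanish at `a` is `O(‖x - a‖ ^ k)` on
balls around `a`. -/
theorem exists_norm_le_mul_pow_of_iteratedFDeriv_eq_zero {E : Type} [NormedAddCommGroup E]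
    [NormedSpace ℝ E] [ProperSpace E] (a : E) (R : ℝ) (k : ℕ) :
    ∀ {F : Type} [NormedAddCommGroup F] [NormedSpace ℝ F] {g : E → F}, ContDiff ℝ k g →
      (∀ j < k, iteratedFDeriv ℝ j g a = 0) →
      ∃ C : ℝ, 0 ≤ C ∧ ∀ x ∈ Metric.closedBall a R, ‖g x‖ ≤ C * ‖x - a‖ ^ k := by
  induction k with
  | zero =>
    intro F _ _ g hg _
    obtain ⟨C, hC⟩ := (isCompact_closedBall a R).exists_bound_of_continuousOn
      hg.continuous.continuousOn
    exact ⟨max C 0, le_max_right _ _, fun x hx => by simpa using Or.inl (hC x hx)⟩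
  | succ k ih =>
    intro F _ _ g hg h0
    have hd : ContDiff ℝ k (fderiv ℝ g) := hg.fderiv_right (by norm_cast)
    obtain ⟨C, hC0, hC⟩ := ih hd fun j hj => by
      rw [← norm_eq_zero, norm_iteratedFDeriv_fderiv, h0 (j + 1) (by omega), norm_zero]
    have hga : g a = 0 := by
      rw [← norm_eq_zero, ← norm_iteratedFDeriv_zero (𝕜 := ℝ), h0 0 (by omega), norm_zero]
    refine ⟨C, hC0, fun x hx => ?_⟩
    have hdiff : Differentiable ℝ g := hg.differentiable (by norm_cast)
    have hsub : Metric.closedBall a ‖x - a‖ ⊆ Metric.closedBall a R :=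
      Metric.closedBall_subset_closedBall (by simpa [dist_eq_norm] using hx)
    have := (convex_closedBall a ‖x - a‖).norm_image_sub_le_of_norm_fderiv_le (𝕜 := ℝ)
      (f := g) (C := C * ‖x - a‖ ^ k) (x := a) (y := x) (fun y _ => hdiff y)
      (fun y hy => (hC y (hsub hy)).trans (by
        gcongr
        simpa [dist_eq_norm] using hy))
      (by simp) (by simp [dist_eq_norm])
    rw [hga, sub_zero] at this
    rwa [pow_succ, ← mul_assoc]

theorem exists_sub_le_mul_pow_of_iteratedFDeriv_eq_zero {n : ℕ}
    {f : EuclideanSpace ℝ (Fin n) → ℝ} {β : ℕ} (hf : ContDiff ℝ β f)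
    {a : EuclideanSpace ℝ (Fin n)}
    (hder : ∀ k : ℕ, 1 ≤ k → k ≤ β - 1 → iteratedFDeriv ℝ k f a = 0) (R : ℝ) :
    ∃ C : ℝ, 0 ≤ C ∧ ∀ x ∈ Metric.closedBall a R, f x - f a ≤ C * ‖x - a‖ ^ β := by
  obtain ⟨C, hC0, hC⟩ := exists_norm_le_mul_pow_of_iteratedFDeriv_eq_zero a R β
    (g := fun x => f x - f a) (hf.sub contDiff_const) (fun j hj => by
      rw [fun_iteratedFDeriv_sub_apply (hf.of_le (by exact_mod_cast hj.le)).contDiffAt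
        contDiffAt_const]
      rcases Nat.eq_zero_or_pos j with rfl | hj0
      · ext v
        simp
      · rw [hder j hj0 (by omega), iteratedFDeriv_const_of_ne hj0.ne']
        simp)
  exact ⟨C, hC0, fun x hx => (le_abs_self _).trans (hC x hx)⟩

/-- The error bound obtained from a Chebyshev needle of width `δ`, in terms of the volume of `K`
close to the minimizer. -/
theorem lasserreError_le_of_needle {n r m : ℕ} {K : Set (EuclideanSpace ℝ (Fin n))}
    (hK : IsCompact K) {f : EuclideanSpace ℝ (Fin n) → ℝ} (hf : Continuous f)
    {a : EuclideanSpace ℝ (Fin n)} (ha : a ∈ K) (hmin : ∀ x ∈ K, f a ≤ f x) (hm : m * 2 ≤ r)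
    {C D δ v : ℝ} {β : ℕ} (hC0 : 0 ≤ C) (hδ : 0 < δ) (hδD : δ ≤ D)
    (hD : K ⊆ Metric.closedBall a D) (hC : ∀ x ∈ K, f x - f a ≤ C * ‖x - a‖ ^ β)
    (hv0 : 0 < v) (hv : v ≤ volume.real (Metric.closedBall a (δ / 2) ∩ K)) :
    lasserreError r K (fun _ => 1) f ≤
      C * δ ^ β + C * D ^ β * volume.real K / (Real.exp (m * δ / D) / 4 * v) := by
  have hDpos : 0 < D := hδ.trans_le hδD
  set P : EuclideanSpace ℝ (Fin n) → ℝ :=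
    fun x => MvPolynomial.eval (fun i => x i) (chebyshevNeedle m a δ D) ^ 2 with hP
  have hPc : Continuous P := (continuous_eval_mvPolynomial _).pow 2
  have hP0 (x) : 0 ≤ P x := sq_nonneg _
  have hint {g : EuclideanSpace ℝ (Fin n) → ℝ} (hg : Continuous g) : IntegrableOn g K :=
    hg.continuousOn.integrableOn_compact hK
  have hKfin : volume K ≠ ⊤ := hK.measure_lt_top.ne
  have hlow : Real.exp (m * δ / D) / 4 * v ≤ ∫ x in K, P x := by
    calc Real.exp (m * δ / D) / 4 * v
        ≤ Real.exp (m * δ / D) / 4 * volume.real (Metric.closedBall a (δ / 2) ∩ K) := by gcongr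
      _ = ∫ _ in Metric.closedBall a (δ / 2) ∩ K, Real.exp (m * δ / D) / 4 := by
          rw [setIntegral_const, smul_eq_mul, mul_comm]
      _ ≤ ∫ x in Metric.closedBall a (δ / 2) ∩ K, P x := by
          refine setIntegral_mono_on ((hint continuous_const).mono_set Set.inter_subset_right)
            ((hint hPc).mono_set Set.inter_subset_right)
            (Metric.isClosed_closedBall.measurableSet.inter hK.measurableSet) fun x hx => ?_
          exact exp_div_four_le_eval_chebyshevNeedle_sq m hδ hδD
            (by simpa [dist_eq_norm] using hx.1)
      _ ≤ ∫ x in K, P x :=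
          setIntegral_mono_set (hint hPc) (Filter.Eventually.of_forall hP0)
            Set.inter_subset_right.eventuallyLE
  have hpos : 0 < Real.exp (m * δ / D) / 4 * v := by positivity
  refine lasserreError_le_of_sq hK hf ha hmin
    ((totalDegree_chebyshevNeedle_le m a δ D).trans hm) (hpos.trans_le hlow) ?_
  calc ∫ x in K, (f x - f a) * P x ≤ ∫ x in K, (C * δ ^ β * P x + C * D ^ β) := by
        refine setIntegral_mono_on (hint (by fun_prop)) (hint (by fun_prop)) hK.measurableSet
          fun x hx => ?_
        have hxD : ‖x - a‖ ≤ D := by simpa [dist_eq_norm] using hD hx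
        rcases le_total ‖x - a‖ δ with h | h
        · have : f x - f a ≤ C * δ ^ β := (hC x hx).trans (by gcongr)
          nlinarith [hP0 x, mul_le_mul_of_nonneg_right this (hP0 x),
            mul_nonneg hC0 (pow_nonneg hDpos.le β)]
        · have h1 : P x ≤ 1 := eval_chebyshevNeedle_sq_le_one m hδ hDpos h hxD
          have h2 : f x - f a ≤ C * D ^ β := (hC x hx).trans (by gcongr)
          have h3 : (f x - f a) * P x ≤ f x - f a :=
            mul_le_of_le_one_right (by linarith [hmin x hx]) h1
          have h4 : 0 ≤ C * δ ^ β * P x := mul_nonneg (by positivity) (hP0 x)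
          linarith
    _ = C * δ ^ β * (∫ x in K, P x) + C * D ^ β * volume.real K := by
        rw [integral_add (hint (by fun_prop)) (hint (by fun_prop)), integral_const_mul,
          setIntegral_const, smul_eq_mul, mul_comm (volume.real K)]
    _ ≤ _ := by
        rw [add_mul]
        refine add_le_add_right ?_ _
        calc C * D ^ β * volume.real K
            = C * D ^ β * volume.real K / (Real.exp (m * δ / D) / 4 * v) *
              (Real.exp (m * δ / D) / 4 * v) := by field_simp
          _ ≤ _ := by gcongr

theorem lasserreError_le_of_sub_le {n : ℕ} (r : ℕ) {K : Set (EuclideanSpace ℝ (Fin n))}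
    (hK : IsCompact K) (hKi : (interior K).Nonempty) {f : EuclideanSpace ℝ (Fin n) → ℝ}
    (hf : Continuous f) {a : EuclideanSpace ℝ (Fin n)} (ha : a ∈ K)
    (hmin : ∀ x ∈ K, f a ≤ f x) {B : ℝ} (hB : ∀ x ∈ K, f x - f a ≤ B) :
    lasserreError r K (fun _ => 1) f ≤ B := by
  have hpos : 0 < volume.real K :=
    ENNReal.toReal_pos (Measure.measure_pos_of_nonempty_interior volume hKi).ne'
      hK.measure_lt_top.ne
  refine lasserreError_le_of_sq hK hf ha hmin (p := 1) (by simp) (by simpa using hpos) ?_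
  simp only [map_one, one_pow, mul_one, setIntegral_const, smul_eq_mul]
  rw [mul_comm, ← smul_eq_mul, ← setIntegral_const]
  exact setIntegral_mono_on ((hf.sub continuous_const).continuousOn.integrableOn_compact hK)
    (continuous_const.continuousOn.integrableOn_compact hK) hK.measurableSet hB

/-- Theorem: for a compact `K ⊆ ℝⁿ` with nonempty interior satisfying Assumption 1,
equipped with the Lebesgue measure, if `f ∈ C^β(ℝⁿ,ℝ)` (`β ≥ 1`) has a global
minimizer `a` on `K` at which all partial derivatives of order `1 ≤ k ≤ β - 1`
vanish, then the Lasserre error is `O((log r)^β / r^β)`. -/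
theorem stmt8 {n : ℕ}
    (K : Set (EuclideanSpace ℝ (Fin n)))
    (hKc : IsCompact K) (hKi : (interior K).Nonempty)
    (hKa : Assumption1 K)
    (β : ℕ) (hβ : 1 ≤ β)
    (f : EuclideanSpace ℝ (Fin n) → ℝ)
    (hf : ContDiff ℝ (β : ℕ∞) f)
    (a : EuclideanSpace ℝ (Fin n)) (ha : a ∈ K)
    (hmin : ∀ x ∈ K, f a ≤ f x)
    (hder : ∀ k : ℕ, 1 ≤ k → k ≤ β - 1 → iteratedFDeriv ℝ k f a = 0) :
    ∃ c : ℝ, 0 < c ∧ ∀ r : ℕ, 2 ≤ r →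
      lasserreError r K (fun _ => 1) f ≤ c * (Real.log r) ^ β / (r : ℝ) ^ β := by
  obtain ⟨εK, ηK, hε, hη, hvol⟩ := hKa
  obtain ⟨D₀, hD₀⟩ := hKc.isBounded.subset_closedBall a
  set D := max D₀ 1
  have hD : K ⊆ Metric.closedBall a D :=
    hD₀.trans (Metric.closedBall_subset_closedBall (le_max_left _ _))
  have hDpos : 0 < D := lt_max_of_lt_right one_pos
  obtain ⟨C, hC0, hCball⟩ := exists_sub_le_mul_pow_of_iteratedFDeriv_eq_zero hf hder D
  have hC : ∀ x ∈ K, f x - f a ≤ C * ‖x - a‖ ^ β := fun x hx => hCball x (hD hx)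
  set V := volume.real (Metric.closedBall (0 : EuclideanSpace ℝ (Fin n)) 1)
  have hV : 0 < V := ENNReal.toReal_pos
    (Metric.measure_closedBall_pos volume _ one_pos).ne' measure_closedBall_lt_top.ne
  set A : ℝ := 4 * D * (n + β) with hA
  have hβ' : (1 : ℝ) ≤ β := by exact_mod_cast hβ
  have hApos : 0 < A := by positivity
  set δ₀ := min εK D
  have hδ₀ : 0 < δ₀ := lt_min hε hDpos
  have hl2 : 0 < Real.log 2 := Real.log_pos one_lt_two
  set c₁ := C * D ^ β * volume.real K * 4 * 2 ^ n / (ηK * V * A ^ n) / Real.log 2 ^ (n + β)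
  have hc₁ : 0 ≤ c₁ := by positivity
  refine ⟨C * A ^ β + c₁ + C * D ^ β * (A / δ₀) ^ β + 1, by positivity, fun r hr => ?_⟩
  have hr' : (2 : ℝ) ≤ r := by exact_mod_cast hr
  have hr0 : (0 : ℝ) < r := by linarith
  set L := Real.log r
  have hL2 : Real.log 2 ≤ L := Real.log_le_log two_pos hr'
  have hL : 0 < L := hl2.trans_le hL2
  rw [mul_div_assoc, ← div_pow]
  set δ := A * (L / r) with hδdef
  have hδ : 0 < δ := by positivity
  rcases le_or_gt δ δ₀ with hsmall | hlarge
  · have hδε : δ / 2 ≤ εK := by linarith [hsmall.trans (min_le_left _ _)]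
    have hv : ηK * (δ / 2) ^ n * V ≤ volume.real (Metric.closedBall a (δ / 2) ∩ K) := by
      have := ENNReal.toReal_mono
        (measure_ne_top_of_subset Set.inter_subset_right hKc.measure_lt_top.ne) (hvol a ha (δ / 2) (by positivity) hδε)
      rwa [ENNReal.toReal_mul, ENNReal.toReal_ofReal (by positivity)] at this
    have hm : (r : ℝ) ≤ 4 * (r / 2 : ℕ) := by exact_mod_cast (by omega : r ≤ 4 * (r / 2))
    have hexp : (r : ℝ) ^ (n + β) ≤ Real.exp ((r / 2 : ℕ) * δ / D) := by
      rw [← Real.exp_log (pow_pos hr0 _), Real.log_pow, Real.exp_le_exp, le_div_iff₀ hDpos]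
      have : (r : ℝ) / 4 * δ = (n + β) * L * D := by
        rw [hδdef, hA]
        field_simp
      push_cast
      rw [← this]
      gcongr
      linarith
    have key := lasserreError_le_of_needle hKc hf.continuous ha hmin
      (Nat.div_mul_le_self r 2) hC0 hδ (hsmall.trans (min_le_right _ _)) hD hC
      (by positivity) hv
    have hsecond : C * D ^ β * volume.real K /
        (Real.exp ((r / 2 : ℕ) * δ / D) / 4 * (ηK * (δ / 2) ^ n * V)) ≤ c₁ * (L / r) ^ β := by
      calc _ ≤ C * D ^ β * volume.real K /
            ((r : ℝ) ^ (n + β) / 4 * (ηK * (δ / 2) ^ n * V)) := by gcongr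
        _ = C * D ^ β * volume.real K * 4 * 2 ^ n / (ηK * V * A ^ n) / L ^ (n + β) *
            (L / r) ^ β := by
          rw [hδdef]
          simp only [div_pow, mul_pow, pow_add]
          field_simp
        _ ≤ c₁ * (L / r) ^ β := by
          refine mul_le_mul_of_nonneg_right ?_ (by positivity)
          exact div_le_div_of_nonneg_left (by positivity) (by positivity) (by gcongr)
    calc _ ≤ C * δ ^ β + c₁ * (L / r) ^ β := key.trans (add_le_add_right hsecond _)
      _ = (C * A ^ β + c₁) * (L / r) ^ β := by rw [hδdef, mul_pow]; ring
      _ ≤ _ := by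
        refine mul_le_mul_of_nonneg_right ?_ (by positivity)
        have : 0 ≤ C * D ^ β * (A / δ₀) ^ β := by positivity
        linarith
  · have hfar := lasserreError_le_of_sub_le r hKc hKi hf.continuous ha hmin
      (B := C * D ^ β) fun x hx => (hC x hx).trans (by
        gcongr
        simpa [dist_eq_norm] using hD hx)
    calc _ ≤ C * D ^ β := hfar
      _ ≤ C * D ^ β * (δ / δ₀) ^ β :=
        le_mul_of_one_le_right (by positivity)
          (one_le_pow₀ ((one_le_div hδ₀).2 hlarge.le))
      _ = C * D ^ β * (A / δ₀) ^ β * (L / r) ^ β := by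
        rw [mul_assoc _ ((A / δ₀) ^ β), ← mul_pow, hδdef]
        congr 2
        ring
      _ ≤ _ := by
        refine mul_le_mul_of_nonneg_right ?_ (by positivity)
        have : 0 ≤ C * A ^ β := by positivity
        linarith
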